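/- Let n ≥ 2, α ∈ (0,1), ν > 0, and let h : [0,∞) → [0,∞) be nondecreasing, not identically zero, and positively homogeneous of degree ν; set g(x) = h(|x|). Define the critical mass m_c = |B_1| · [ (α(n−α))/(ν(n+ν)) · P_α(B_1) / ∫_{B_1} g(x) dx ]^{n/(ν+α)}. Then the function φ(m) = inf{ 𝓔(E) : E ⊆ ℝⁿ measurable, |E| = m } satisfies φ(m) = P_α(B_1) |B_1|^{−(n−α)/n} m^{(n−α)/n} + (∫_{B_1} g(x) dx) |B_1|^{−(n+ν)/n} m^{(n+ν)/n} for all m > 0, and φ is concave on (0, m_c) and convex on (m_c, ∞). -/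

import Mathlib

open MeasureTheory Metric Set
open scoped ENNReal

/-- The fractional (nonlocal) perimeter `P_α(E) = ∫_E ∫_{Eᶜ} |x-y|^{-(n+α)} dy dx`. -/
noncomputable def fracPerimeter (n : ℕ) (α : ℝ) (E : Set (EuclideanSpace ℝ (Fin n))) : ℝ≥0∞ :=
  ∫⁻ x in E, ∫⁻ y in Eᶜ, ENNReal.ofReal (‖x - y‖ ^ (-((n : ℝ) + α)))

/-- The nonlocal free energy `𝓔(E) = P_α(E) + ∫_E g`. -/
noncomputable def freeEnergy (n : ℕ) (α : ℝ) (g : EuclideanSpace ℝ (Fin n) → ℝ)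
    (E : Set (EuclideanSpace ℝ (Fin n))) : ℝ≥0∞ :=
  fracPerimeter n α E + ∫⁻ x in E, ENNReal.ofReal (g x)

/-- The minimal energy among measurable sets of volume `m`. -/
noncomputable def minEnergy (n : ℕ) (α : ℝ) (g : EuclideanSpace ℝ (Fin n) → ℝ) (m : ℝ) : ℝ≥0∞ :=
  ⨅ (E : Set (EuclideanSpace ℝ (Fin n)))
    (_ : MeasurableSet E ∧ volume E = ENNReal.ofReal m), freeEnergy n α g E

section Polarization

variable {V : Type*} [NormedAddCommGroup V]

/-- The two-point symmetrization of `E` with respect to `σ`: of the two points `x`, `σ x`, the one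
closer to the origin is favoured. -/
def polarize (σ : V → V) (E : Set V) : Set V :=
  {x | (‖x‖ ≤ ‖σ x‖ ∧ (x ∈ E ∨ σ x ∈ E)) ∨ (x ∈ E ∧ σ x ∈ E)}

/-- The properties of reflections across hyperplanes avoiding the origin that are used for
two-point symmetrization. -/
structure IsPolarizer [MeasurableSpace V] (μ : Measure V) (σ : V → V) : Prop where
  involutive : Function.Involutive σ
  isometry : Isometry σ
  measurePreserving : MeasurePreserving σ μ μ
  eq_of_norm_eq : ∀ x, ‖σ x‖ = ‖x‖ → σ x = x
  edist_le : ∀ x y, ‖x‖ ≤ ‖σ x‖ → ‖y‖ ≤ ‖σ y‖ → edist x y ≤ edist x (σ y)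

/-- The energy of interaction of `E` with its complement, for the kernel `k (edist x y)`. -/
noncomputable def interaction [MeasurableSpace V] (μ : Measure V) (k : ℝ≥0∞ → ℝ≥0∞) (E : Set V) :
    ℝ≥0∞ :=
  ∫⁻ p, (E ×ˢ Eᶜ).indicator (fun p => k (edist p.1 p.2)) p ∂(μ.prod μ)

theorem mem_polarize_iff {σ : V → V} {E : Set V} {x : V} (hx : ‖x‖ ≤ ‖σ x‖) :
    x ∈ polarize σ E ↔ x ∈ E ∨ σ x ∈ E := by
  simp only [polarize, mem_ofPred_eq, hx, true_and]
  tauto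

variable [MeasurableSpace V] {μ : Measure V} {σ : V → V}

theorem MeasureTheory.MeasurePreserving.lintegral_add_comp {X : Type*} [MeasurableSpace X]
    {ν : Measure X} {T : X → X} (hT : MeasurePreserving T ν ν) {f : X → ℝ≥0∞} (hf : Measurable f) :
    ∫⁻ x, (f x + f (T x)) ∂ν = 2 * ∫⁻ x, f x ∂ν := by
  rw [lintegral_add_left hf, hT.lintegral_comp hf, two_mul]

theorem IsPolarizer.apply_mem_polarize (hσ : IsPolarizer μ σ) {E : Set V} {x : V}
    (hx : ‖x‖ ≤ ‖σ x‖) : σ x ∈ polarize σ E ↔ x ∈ E ∧ σ x ∈ E := by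
  simp only [polarize, mem_ofPred_eq, hσ.involutive x]
  constructor
  · rintro (⟨h1, h2⟩ | h)
    · have := hσ.eq_of_norm_eq x (le_antisymm h1 hx)
      rw [this] at h2 ⊢
      tauto
    · tauto
  · tauto

theorem IsPolarizer.measurableSet_polarize [OpensMeasurableSpace V]
    (hσ : IsPolarizer μ σ) {E : Set V} (hE : MeasurableSet E) :
    MeasurableSet (polarize σ E) := by
  have h1 : MeasurableSet (σ ⁻¹' E) := hσ.measurePreserving.measurable hE
  have h2 : MeasurableSet {x : V | ‖x‖ ≤ ‖σ x‖} :=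
    (isClosed_le continuous_norm (continuous_norm.comp hσ.isometry.continuous)).measurableSet
  exact (h2.inter (hE.union h1)).union (hE.inter h1)

theorem IsPolarizer.measure_polarize [OpensMeasurableSpace V]
    (hσ : IsPolarizer μ σ) {E : Set V} (hE : MeasurableSet E) :
    μ (polarize σ E) = μ E := by
  have hP := hσ.measurableSet_polarize hE
  have key : ∀ x, ‖x‖ ≤ ‖σ x‖ →
      (polarize σ E).indicator (1 : V → ℝ≥0∞) x + (polarize σ E).indicator 1 (σ x)
        = E.indicator 1 x + E.indicator 1 (σ x) := by
    intro x hx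
    have h1 := mem_polarize_iff (E := E) hx
    have h2 := hσ.apply_mem_polarize (E := E) hx
    by_cases p : x ∈ E <;> by_cases q : σ x ∈ E <;> simp_all [indicator]
  have h2 : 2 * μ (polarize σ E) = 2 * μ E := by
    rw [← lintegral_indicator_one hP, ← lintegral_indicator_one hE,
      ← hσ.measurePreserving.lintegral_add_comp (measurable_one.indicator hP),
      ← hσ.measurePreserving.lintegral_add_comp (measurable_one.indicator hE)]
    refine lintegral_congr fun x => ?_
    rcases le_total ‖x‖ ‖σ x‖ with hx | hx
    · exact key x hx
    · have := key (σ x) (by rwa [hσ.involutive x])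
      rw [hσ.involutive x] at this
      rw [add_comm, this, add_comm]
  exact (ENNReal.mul_right_inj two_ne_zero ENNReal.ofNat_ne_top).1 h2

open Classical in
theorem IsPolarizer.measure_inter_ball_add_le [OpensMeasurableSpace V]
    (hσ : IsPolarizer μ σ) {E : Set V} (hE : MeasurableSet E) (r : ℝ) :
    μ (E ∩ ball 0 r) + μ ((ball 0 r \ E) ∩ σ ⁻¹' (E \ ball 0 r))
      ≤ μ (polarize σ E ∩ ball 0 r) := by
  have hP := (hσ.measurableSet_polarize hE).inter (measurableSet_ball (x := (0 : V)) (ε := r))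
  have hB := hE.inter (measurableSet_ball (x := (0 : V)) (ε := r))
  have hG : MeasurableSet ((ball 0 r \ E) ∩ σ ⁻¹' (E \ ball 0 r)) :=
    (measurableSet_ball.diff hE).inter
      (hσ.measurePreserving.measurable (hE.diff measurableSet_ball))
  have key : ∀ x, ‖x‖ ≤ ‖σ x‖ →
      ((E ∩ ball 0 r).indicator (1 : V → ℝ≥0∞) x + (E ∩ ball 0 r).indicator 1 (σ x)) +
        (((ball 0 r \ E) ∩ σ ⁻¹' (E \ ball 0 r)).indicator 1 x +
          ((ball 0 r \ E) ∩ σ ⁻¹' (E \ ball 0 r)).indicator 1 (σ x)) ≤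
      (polarize σ E ∩ ball 0 r).indicator (1 : V → ℝ≥0∞) x +
        (polarize σ E ∩ ball 0 r).indicator 1 (σ x) := by
    intro x hx
    have h1 := mem_polarize_iff (E := E) hx
    have h2 := hσ.apply_mem_polarize (E := E) hx
    have h3 : ‖σ x‖ < r → ‖x‖ < r := hx.trans_lt
    have h4 := hσ.involutive x
    simp only [indicator_apply, mem_inter_iff, mem_sdiff, mem_preimage, mem_ball_zero_iff, h1, h2,
      h4, Pi.one_apply]
    by_cases p : x ∈ E <;> by_cases q : σ x ∈ E <;> by_cases s : ‖σ x‖ < r <;>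
      by_cases t : ‖x‖ < r <;> simp [p, q, s, t] <;> exact t (h3 s)
  have hB' : Measurable fun x =>
      (E ∩ ball 0 r).indicator (1 : V → ℝ≥0∞) x + (E ∩ ball 0 r).indicator 1 (σ x) :=
    (measurable_one.indicator hB).add
      ((measurable_one.indicator hB).comp hσ.measurePreserving.measurable)
  have h2 : 2 * (μ (E ∩ ball 0 r) + μ ((ball 0 r \ E) ∩ σ ⁻¹' (E \ ball 0 r)))
      ≤ 2 * μ (polarize σ E ∩ ball 0 r) := by
    rw [mul_add, ← lintegral_indicator_one hP, ← lintegral_indicator_one hB,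
      ← lintegral_indicator_one hG,
      ← hσ.measurePreserving.lintegral_add_comp (measurable_one.indicator hP),
      ← hσ.measurePreserving.lintegral_add_comp (measurable_one.indicator hB),
      ← hσ.measurePreserving.lintegral_add_comp (measurable_one.indicator hG),
      ← lintegral_add_left hB']
    refine lintegral_mono fun x => ?_
    rcases le_total ‖x‖ ‖σ x‖ with hx | hx
    · exact key x hx
    · have := key (σ x) (by rwa [hσ.involutive x])
      rw [hσ.involutive x] at this
      simpa only [add_comm] using this
  exact (ENNReal.mul_le_mul_iff_right two_ne_zero ENNReal.ofNat_ne_top).1 h2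

theorem measurable_interaction_integrand [OpensMeasurableSpace V] [SecondCountableTopology V]
    {k : ℝ≥0∞ → ℝ≥0∞} (hk : Antitone k) {E : Set V} (hE : MeasurableSet E) :
    Measurable ((E ×ˢ Eᶜ).indicator (fun p : V × V => k (edist p.1 p.2))) :=
  (hk.measurable.comp (measurable_fst.edist measurable_snd)).indicator (hE.prod hE.compl)

open Classical in
theorem IsPolarizer.interaction_polarize_le [OpensMeasurableSpace V] [SecondCountableTopology V]
    [SFinite μ] (hσ : IsPolarizer μ σ) {k : ℝ≥0∞ → ℝ≥0∞} (hk : Antitone k) {E : Set V}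
    (hE : MeasurableSet E) : interaction μ k (polarize σ E) ≤ interaction μ k E := by
  have hP := hσ.measurableSet_polarize hE
  set f : Set V → V × V → ℝ≥0∞ := fun E =>
    (E ×ˢ Eᶜ).indicator (fun p : V × V => k (edist p.1 p.2)) with hf
  set S : Set V → V → V → ℝ≥0∞ := fun E x y =>
    f E (x, y) + f E (σ x, y) + (f E (x, σ y) + f E (σ x, σ y)) with hS
  have hfst : MeasurePreserving (Prod.map σ id) (μ.prod μ) (μ.prod μ) :=
    hσ.measurePreserving.prod (MeasurePreserving.id μ)
  have hsnd : MeasurePreserving (Prod.map id σ) (μ.prod μ) (μ.prod μ) :=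
    (MeasurePreserving.id μ).prod hσ.measurePreserving
  have hint : ∀ F : Set V, MeasurableSet F →
      2 * (2 * interaction μ k F) = ∫⁻ p, S F p.1 p.2 ∂(μ.prod μ) := by
    intro F hF
    have hm : Measurable (f F) := measurable_interaction_integrand hk hF
    change 2 * (2 * ∫⁻ p, f F p ∂(μ.prod μ)) = _
    have hm' : Measurable fun p => f F p + f F (Prod.map σ id p) :=
      hm.add (hm.comp hfst.measurable)
    rw [← hfst.lintegral_add_comp hm, ← hsnd.lintegral_add_comp hm']
    rfl
  have hS1 : ∀ F x y, S F (σ x) y = S F x y := by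
    intro F x y
    simp only [hS, hσ.involutive x]
    ring
  have hS2 : ∀ F x y, S F x (σ y) = S F x y := by
    intro F x y
    simp only [hS, hσ.involutive y]
    ring
  have hfapp : ∀ F x y, f F (x, y) = if x ∈ F ∧ y ∉ F then k (edist x y) else 0 := by
    intro F x y
    simp only [hf, indicator_apply, mem_prod, mem_compl_iff]
  have key : ∀ x y, ‖x‖ ≤ ‖σ x‖ → ‖y‖ ≤ ‖σ y‖ → S (polarize σ E) x y ≤ S E x y := by
    intro x y hx hy
    have h1 := mem_polarize_iff (E := E) hx
    have h2 := hσ.apply_mem_polarize (E := E) hx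
    have h3 := mem_polarize_iff (E := E) hy
    have h4 := hσ.apply_mem_polarize (E := E) hy
    have e1 : edist (σ x) (σ y) = edist x y := hσ.isometry.edist_eq x y
    have e2 : edist (σ x) y = edist x (σ y) := by
      rw [← hσ.isometry.edist_eq, hσ.involutive x]
    have hab : k (edist x (σ y)) ≤ k (edist x y) := hk (hσ.edist_le x y hx hy)
    simp only [hS, hfapp, h1, h2, h3, h4, e1, e2]
    generalize k (edist x (σ y)) = b at *
    generalize k (edist x y) = a at *
    by_cases p : x ∈ E <;> by_cases p' : σ x ∈ E <;> by_cases q : y ∈ E <;>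
      by_cases q' : σ y ∈ E <;> simp [p, p', q, q', hab, add_comm]
  have h4 : 2 * (2 * interaction μ k (polarize σ E)) ≤ 2 * (2 * interaction μ k E) := by
    rw [hint _ hP, hint _ hE]
    refine lintegral_mono fun p => ?_
    obtain ⟨x, y⟩ := p
    rcases le_total ‖x‖ ‖σ x‖ with hx | hx <;> rcases le_total ‖y‖ ‖σ y‖ with hy | hy
    · exact key x y hx hy
    · simpa only [hS2] using key x (σ y) hx (by rwa [hσ.involutive y])
    · simpa only [hS1] using key (σ x) y (by rwa [hσ.involutive x]) hy
    · simpa only [hS1, hS2] using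
        key (σ x) (σ y) (by rwa [hσ.involutive x]) (by rwa [hσ.involutive y])
  rwa [ENNReal.mul_le_mul_iff_right two_ne_zero ENNReal.ofNat_ne_top,
    ENNReal.mul_le_mul_iff_right two_ne_zero ENNReal.ofNat_ne_top] at h4

end Polarization

section Reflection

variable {V : Type*} [NormedAddCommGroup V] [InnerProductSpace ℝ V]

/-- The reflection across the hyperplane bisecting the segment from `0` to `w`. -/
noncomputable def reflectTo (w x : V) : V := x + (1 - 2 * inner ℝ x w / ‖w‖ ^ 2) • w

theorem reflectTo_eq_reflection_add (w x : V) :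
    reflectTo w x = (ℝ ∙ w)ᗮ.reflection x + w := by
  rw [Submodule.reflection_orthogonal_apply, Submodule.reflection_singleton_apply, reflectTo,
    real_inner_comm]
  simp only [RCLike.ofReal_real_eq_id, id_eq]
  module

theorem norm_reflectTo (w x : V) : ‖reflectTo w x‖ = ‖x - w‖ := by
  have h : reflectTo w x = (ℝ ∙ w)ᗮ.reflection (x - w) := by
    rw [reflectTo_eq_reflection_add w x, map_sub,
      Submodule.reflection_orthogonalComplement_singleton_eq_neg, sub_neg_eq_add]
  rw [h, LinearIsometryEquiv.norm_map]

theorem involutive_reflectTo (w : V) : Function.Involutive (reflectTo w) := by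
  intro x
  rw [reflectTo_eq_reflection_add w _, reflectTo_eq_reflection_add w _, map_add,
    Submodule.reflection_reflection, Submodule.reflection_orthogonalComplement_singleton_eq_neg,
    neg_add_cancel_right]

theorem isometry_reflectTo (w : V) : Isometry (reflectTo w) := by
  refine Isometry.of_dist_eq fun x y => ?_
  rw [reflectTo_eq_reflection_add w _, reflectTo_eq_reflection_add w _, dist_add_right,
    LinearIsometryEquiv.dist_map]

theorem norm_le_norm_reflectTo_iff {w x : V} :
    ‖x‖ ≤ ‖reflectTo w x‖ ↔ 2 * inner ℝ x w ≤ ‖w‖ ^ 2 := by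
  rw [norm_reflectTo w x, ← sq_le_sq₀ (norm_nonneg _) (norm_nonneg _), norm_sub_sq_real]
  constructor <;> intro h <;> linarith

theorem norm_reflectTo_eq_iff {w x : V} :
    ‖reflectTo w x‖ = ‖x‖ ↔ 2 * inner ℝ x w = ‖w‖ ^ 2 := by
  rw [norm_reflectTo w x, ← sq_eq_sq₀ (norm_nonneg _) (norm_nonneg _), norm_sub_sq_real]
  constructor <;> intro h <;> linarith

theorem norm_sub_le_norm_sub_reflectTo {w x y : V} (hw : w ≠ 0) (hx : ‖x‖ ≤ ‖reflectTo w x‖)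
    (hy : ‖y‖ ≤ ‖reflectTo w y‖) : ‖x - y‖ ≤ ‖x - reflectTo w y‖ := by
  rw [norm_le_norm_reflectTo_iff] at hx hy
  have hw2 : 0 < ‖w‖ ^ 2 := by positivity
  set t := 1 - 2 * inner ℝ y w / ‖w‖ ^ 2 with ht
  have htw : t * ‖w‖ ^ 2 = ‖w‖ ^ 2 - 2 * inner ℝ y w := by
    rw [ht]; field_simp
  have ht0 : 0 ≤ t := by
    by_contra! h
    nlinarith
  have hr : x - reflectTo w y = (x - y) - t • w := by
    rw [reflectTo, ← ht]; abel
  rw [hr, ← sq_le_sq₀ (norm_nonneg _) (norm_nonneg _), norm_sub_sq_real (x - y), inner_smul_right,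
    inner_sub_left, norm_smul, mul_pow, Real.norm_eq_abs, sq_abs]
  nlinarith [mul_nonneg ht0 (sub_nonneg.2 hx)]

theorem norm_normalize_sub_le {ε : ℝ} (hε : 0 < ε) {w w' : V} (hw : ε ≤ ‖w‖) (hw' : ε ≤ ‖w'‖) :
    ‖‖w‖⁻¹ • w - ‖w'‖⁻¹ • w'‖ ≤ 2 / ε * ‖w - w'‖ := by
  have h0 : 0 < ‖w‖ := hε.trans_le hw
  have h0' : 0 < ‖w'‖ := hε.trans_le hw'
  have e : ‖w‖⁻¹ • w - ‖w'‖⁻¹ • w' = ‖w‖⁻¹ • ((w - w') + ((‖w'‖ - ‖w‖) * ‖w'‖⁻¹) • w') := by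
    rw [sub_mul, mul_inv_cancel₀ h0'.ne', sub_smul, one_smul, mul_smul, smul_add, smul_sub,
      smul_sub, smul_smul ‖w‖⁻¹ ‖w‖, inv_mul_cancel₀ h0.ne', one_smul]
    abel
  rw [e, norm_smul, norm_inv, norm_norm]
  have h1 : ‖(w - w') + ((‖w'‖ - ‖w‖) * ‖w'‖⁻¹) • w'‖ ≤ 2 * ‖w - w'‖ := by
    refine (norm_add_le _ _).trans ?_
    rw [norm_smul, norm_mul, norm_inv, norm_norm, mul_assoc, inv_mul_cancel₀ h0'.ne', mul_one,
      Real.norm_eq_abs]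
    have := abs_norm_sub_norm_le w' w
    rw [norm_sub_rev w' w] at this
    linarith
  calc ‖w‖⁻¹ * ‖(w - w') + ((‖w'‖ - ‖w‖) * ‖w'‖⁻¹) • w'‖ ≤ ε⁻¹ * (2 * ‖w - w'‖) := by gcongr
    _ = 2 / ε * ‖w - w'‖ := by ring

theorem lipschitzOnWith_reflectTo {ε R : ℝ} (hε : 0 < ε) (hR : 0 ≤ R) {x : V} (hx : ‖x‖ ≤ R) :
    LipschitzOnWith (1 + 8 * R / ε).toNNReal (fun w => reflectTo w x) {w | ε ≤ ‖w‖} := by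
  refine LipschitzOnWith.of_dist_le_mul fun w hw w' hw' => ?_
  rw [mem_ofPred_eq] at hw hw'
  rw [Real.coe_toNNReal _ (by positivity), dist_eq_norm, dist_eq_norm]
  have hu := norm_normalize_sub_le hε hw hw'
  have h0 : 0 < ‖w‖ := hε.trans_le hw
  have h0' : 0 < ‖w'‖ := hε.trans_le hw'
  have hform : ∀ w : V, reflectTo w x
      = x + w - (2 * inner ℝ x (‖w‖⁻¹ • w)) • (‖w‖⁻¹ • w) := by
    intro w
    rw [reflectTo, inner_smul_right, smul_smul, sub_smul, one_smul]
    have : 2 * inner ℝ x w / ‖w‖ ^ 2 = 2 * (‖w‖⁻¹ * inner ℝ x w) * ‖w‖⁻¹ := by ring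
    rw [this]
    abel
  have hnorm : ‖‖w'‖⁻¹ • w'‖ = 1 := by
    rw [norm_smul, norm_inv, norm_norm, inv_mul_cancel₀ h0'.ne']
  have hnorm' : ‖‖w‖⁻¹ • w‖ = 1 := by
    rw [norm_smul, norm_inv, norm_norm, inv_mul_cancel₀ h0.ne']
  rw [hform w, hform w']
  generalize ‖w‖⁻¹ • w = u at *
  generalize ‖w'‖⁻¹ • w' = u' at *
  have e : x + w - (2 * inner ℝ x u) • u - (x + w' - (2 * inner ℝ x u') • u')
      = (w - w') - ((2 * inner ℝ x u) • (u - u') + (2 * inner ℝ x (u - u')) • u') := by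
    rw [inner_sub_right, mul_sub, sub_smul, smul_sub]
    abel
  rw [e]
  have h1 : ‖(2 * inner ℝ x u) • (u - u')‖ ≤ 2 * R * ‖u - u'‖ := by
    rw [norm_smul, norm_mul, Real.norm_two]
    have := norm_inner_le_norm (𝕜 := ℝ) x u
    rw [hnorm', mul_one] at this
    gcongr
    exact this.trans hx
  have h2 : ‖(2 * inner ℝ x (u - u')) • u'‖ ≤ 2 * R * ‖u - u'‖ := by
    rw [norm_smul, norm_mul, Real.norm_two, hnorm, mul_one, mul_assoc]
    have := norm_inner_le_norm (𝕜 := ℝ) x (u - u')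
    gcongr
    exact this.trans (by gcongr)
  calc _ ≤ ‖w - w'‖ + (2 * R * ‖u - u'‖ + 2 * R * ‖u - u'‖) :=
        (norm_sub_le _ _).trans (by gcongr; exact (norm_add_le _ _).trans (add_le_add h1 h2))
    _ = ‖w - w'‖ + 4 * R * ‖u - u'‖ := by ring
    _ ≤ ‖w - w'‖ + 4 * R * (2 / ε * ‖w - w'‖) := by gcongr
    _ = _ := by ring

/-- Any two points at different distances from the origin are exchanged by a reflection, with an
explicit control on the corresponding hyperplane. -/
theorem exists_reflectTo_eq {x y : V} (h : ‖x‖ < ‖y‖) :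
    ∃ w, ‖y‖ - ‖x‖ ≤ ‖w‖ ∧ ‖w‖ ≤ ‖x‖ + ‖y‖ ∧ reflectTo w x = y := by
  have hz : y - x ≠ 0 := sub_ne_zero.2 (by rintro rfl; exact h.false)
  have hz0 : 0 < ‖y - x‖ := norm_pos_iff.2 hz
  set t := (‖y‖ ^ 2 - ‖x‖ ^ 2) / ‖y - x‖ ^ 2 with ht
  have hd : 0 < ‖y‖ ^ 2 - ‖x‖ ^ 2 := by nlinarith [norm_nonneg x]
  have ht0 : 0 < t := by positivity
  have hw : ‖t • (y - x)‖ = (‖y‖ - ‖x‖) * (‖x‖ + ‖y‖) / ‖y - x‖ := by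
    rw [norm_smul, Real.norm_eq_abs, abs_of_pos ht0, ht]
    field_simp
    ring
  have h1 : ‖y - x‖ ≤ ‖x‖ + ‖y‖ := (norm_sub_le _ _).trans_eq (add_comm _ _)
  have h2 : ‖y‖ - ‖x‖ ≤ ‖y - x‖ := norm_sub_norm_le _ _
  refine ⟨t • (y - x), ?_, ?_, ?_⟩
  · rw [hw, le_div_iff₀ hz0]
    exact mul_le_mul_of_nonneg_left h1 (sub_nonneg.2 h.le)
  · rw [hw, div_le_iff₀ hz0, mul_comm]
    exact mul_le_mul_of_nonneg_left h2 (by positivity)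
  · have e : (1 - 2 * inner ℝ x (t • (y - x)) / ‖t • (y - x)‖ ^ 2) * t = 1 := by
      rw [inner_smul_right, norm_smul, mul_pow, Real.norm_eq_abs, sq_abs]
      have h3 : ‖y‖ ^ 2 = ‖x‖ ^ 2 + 2 * inner ℝ x (y - x) + ‖y - x‖ ^ 2 := by
        rw [← norm_add_sq_real, add_sub_cancel]
      have h4 : t * ‖y - x‖ ^ 2 = ‖y‖ ^ 2 - ‖x‖ ^ 2 := by
        rw [ht]; field_simp
      field_simp
      nlinarith
    rw [reflectTo, smul_smul, e, one_smul, add_sub_cancel]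

variable [FiniteDimensional ℝ V] [MeasurableSpace V] [BorelSpace V]

theorem measurePreserving_reflectTo (w : V) :
    MeasurePreserving (reflectTo w) (volume : Measure V) volume := by
  have : reflectTo w = (· + w) ∘ (ℝ ∙ w)ᗮ.reflection := by
    ext x
    exact reflectTo_eq_reflection_add w x
  rw [this]
  exact (measurePreserving_add_right volume w).comp (LinearIsometryEquiv.measurePreserving _)

theorem LipschitzOnWith.addHaar_image_le (μ : Measure V) [μ.IsAddHaarMeasure] {K : NNReal}
    {f : V → V} {s : Set V} (hf : LipschitzOnWith K f s) :
    μ (f '' s) ≤ (K : ℝ≥0∞) ^ Module.finrank ℝ V * μ s := by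
  rw [Measure.isAddLeftInvariant_eq_smul μ (μH[Module.finrank ℝ V])]
  simp only [Measure.smul_apply, ENNReal.smul_def, smul_eq_mul]
  have := hf.hausdorffMeasure_image_le (d := Module.finrank ℝ V) (by positivity)
  rw [ENNReal.rpow_natCast] at this
  calc _ ≤ _ := mul_le_mul_right this _
    _ = _ := by ring

theorem measurable_reflectTo : Measurable (fun p : V × V => reflectTo p.1 p.2) := by
  unfold reflectTo
  fun_prop

theorem isPolarizer_reflectTo (w : V) (hw : w ≠ 0) :
    IsPolarizer (volume : Measure V) (reflectTo w) where
  involutive := involutive_reflectTo w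
  isometry := isometry_reflectTo w
  measurePreserving := measurePreserving_reflectTo w
  eq_of_norm_eq x hx := by
    rw [norm_reflectTo_eq_iff] at hx
    have : ‖w‖ ^ 2 ≠ 0 := by positivity
    rw [reflectTo, hx, div_self this, sub_self, zero_smul, add_zero]
  edist_le x y hx hy := by
    rw [edist_dist, edist_dist, dist_eq_norm, dist_eq_norm]
    exact ENNReal.ofReal_le_ofReal (norm_sub_le_norm_sub_reflectTo hw hx hy)

/-- For sets `A` and `C` lying inside and outside of concentric spheres, respectively, some
reflection maps a definite amount of `A` to `C`. -/
theorem exists_reflectTo_measure_inter_ge (μ : Measure V) [μ.IsAddHaarMeasure] {s r : ℝ}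
    (hsr : s < r) (R : ℝ) :
    ∃ c : ℝ≥0∞, c ≠ 0 ∧ ∀ A C : Set V, MeasurableSet A → MeasurableSet C → μ A ≠ 0 → μ C ≠ 0 →
      (∀ x ∈ A, ‖x‖ ≤ s) → (∀ y ∈ C, r ≤ ‖y‖ ∧ ‖y‖ ≤ R) →
      ∃ w ≠ 0, c * (μ A * μ C) ≤ μ (A ∩ reflectTo w ⁻¹' C) := by
  set W : Set V := {w | r - s ≤ ‖w‖} ∩ closedBall 0 (s + R) with hW
  have hWm : MeasurableSet W :=
    (isClosed_le continuous_const continuous_norm).measurableSet.inter measurableSet_closedBall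
  have hWfin : μ W ≠ ∞ := ne_top_of_le_ne_top measure_closedBall_lt_top.ne
    (measure_mono inter_subset_right)
  set K : ℝ≥0∞ := ((1 + 8 * |s| / (r - s)).toNNReal : ℝ≥0∞) ^ Module.finrank ℝ V with hK
  have hε : 0 < r - s := sub_pos.2 hsr
  have hK0 : K ≠ 0 := by
    refine pow_ne_zero _ ?_
    rw [Ne, ENNReal.coe_eq_zero, Real.toNNReal_eq_zero, not_le]
    positivity
  have hKtop : K ≠ ∞ := ENNReal.pow_ne_top ENNReal.coe_ne_top
  have hD0 : K * (μ W + 1) ≠ 0 := mul_ne_zero hK0 (by simp)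
  have hDtop : K * (μ W + 1) ≠ ∞ := ENNReal.mul_ne_top hKtop (by simp [hWfin])
  refine ⟨(K * (μ W + 1))⁻¹, ENNReal.inv_ne_zero.2 hDtop, ?_⟩
  intro A C hA hC hA0 hC0 hAs hCr
  have hAtop : μ A ≠ ∞ := ne_top_of_le_ne_top (measure_closedBall_lt_top (x := (0 : V))).ne
    (measure_mono fun x hx => mem_closedBall_zero_iff.2 (hAs x hx))
  have hCtop : μ C ≠ ∞ := ne_top_of_le_ne_top (measure_closedBall_lt_top (x := (0 : V))).ne
    (measure_mono fun x hx => mem_closedBall_zero_iff.2 (hCr x hx).2)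
  by_contra! hcon
  set p := μ A * μ C with hp
  have hp0 : p ≠ 0 := mul_ne_zero hA0 hC0
  have hptop : p ≠ ∞ := ENNReal.mul_ne_top hAtop hCtop
  set c := (K * (μ W + 1))⁻¹ with hc
  have hfib : ∀ x ∈ A, μ C ≤ K * μ (W ∩ {w | reflectTo w x ∈ C}) := by
    intro x hx
    have hs : 0 ≤ s := (norm_nonneg x).trans (hAs x hx)
    have hsub : C ⊆ (fun w => reflectTo w x) '' (W ∩ {w | reflectTo w x ∈ C}) := by
      intro y hy
      obtain ⟨hy1, hy2⟩ := hCr y hy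
      have hxs := hAs x hx
      obtain ⟨w, h1, h2, rfl⟩ := exists_reflectTo_eq (x := x) (y := y) (by linarith)
      refine ⟨w, ⟨⟨?_, ?_⟩, hy⟩, rfl⟩
      · simp only [mem_ofPred_eq]; linarith
      · rw [mem_closedBall_zero_iff]; linarith
    have hlip := lipschitzOnWith_reflectTo hε (abs_nonneg s) ((hAs x hx).trans (le_abs_self s))
    exact (measure_mono hsub).trans ((hlip.mono fun w hw => hw.1.1).addHaar_image_le μ)
  have hmeas : Measurable (fun q : V × V => C.indicator (1 : V → ℝ≥0∞) (reflectTo q.1 q.2)) :=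
    (measurable_one.indicator hC).comp measurable_reflectTo
  have hswap : ∫⁻ w in W, μ (A ∩ reflectTo w ⁻¹' C) ∂μ
      = ∫⁻ x in A, μ (W ∩ {w | reflectTo w x ∈ C}) ∂μ := by
    have h1 : ∀ w, μ (A ∩ reflectTo w ⁻¹' C)
        = ∫⁻ x in A, C.indicator (1 : V → ℝ≥0∞) (reflectTo w x) ∂μ := by
      intro w
      have hm : MeasurableSet (reflectTo w ⁻¹' C) :=
        (measurable_reflectTo.comp measurable_prodMk_left) hC
      rw [inter_comm, ← Measure.restrict_apply hm, ← lintegral_indicator_one hm]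
      rfl
    have h2 : ∀ x, μ (W ∩ {w | reflectTo w x ∈ C})
        = ∫⁻ w in W, C.indicator (1 : V → ℝ≥0∞) (reflectTo w x) ∂μ := by
      intro x
      have hm : MeasurableSet {w | reflectTo w x ∈ C} :=
        (measurable_reflectTo.comp measurable_prodMk_right) hC
      rw [inter_comm, ← Measure.restrict_apply hm, ← lintegral_indicator_one hm]
      rfl
    simp_rw [h1, h2]
    exact lintegral_lintegral_swap hmeas.aemeasurable
  have hle : p ≤ p * c * K * μ W := by
    calc p = ∫⁻ _ in A, μ C ∂μ := by rw [setLIntegral_const, hp, mul_comm]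
      _ ≤ ∫⁻ x in A, K * μ (W ∩ {w | reflectTo w x ∈ C}) ∂μ := setLIntegral_mono' hA hfib
      _ = K * ∫⁻ w in W, μ (A ∩ reflectTo w ⁻¹' C) ∂μ := by
        rw [lintegral_const_mul' _ _ hKtop, hswap]
      _ ≤ K * ∫⁻ w in W, c * p ∂μ := by
        refine mul_le_mul_right (setLIntegral_mono' hWm fun w hw => (hcon w ?_).le) _
        rintro rfl
        have := hw.1
        simp only [mem_ofPred_eq, norm_zero] at this
        linarith
      _ = p * c * K * μ W := by rw [setLIntegral_const]; ring
  have hcD : c * (K * (μ W + 1)) = 1 := ENNReal.inv_mul_cancel hD0 hDtop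
  have hpD : p = p * c * K * μ W + p * c * K := by
    calc p = p * (c * (K * (μ W + 1))) := by rw [hcD, mul_one]
      _ = _ := by ring
  have hctop : c ≠ ∞ := ENNReal.inv_ne_top.2 hD0
  have hq0 : p * c * K ≠ 0 :=
    mul_ne_zero (mul_ne_zero hp0 (ENNReal.inv_ne_zero.2 hDtop)) hK0
  have hqtop : p * c * K * μ W ≠ ∞ :=
    ENNReal.mul_ne_top (ENNReal.mul_ne_top (ENNReal.mul_ne_top hptop hctop) hKtop) hWfin
  exact (ENNReal.lt_add_right hqtop hq0).not_ge (hpD ▸ hle)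

end Reflection

section Rearrangement

variable {V : Type*} [NormedAddCommGroup V] [InnerProductSpace ℝ V] [FiniteDimensional ℝ V]
  [MeasurableSpace V] [BorelSpace V]

theorem exists_nat_measure_lt_measure_inter_ball_add (E : Set V) (hE : volume E ≠ ∞)
    {δ : ℝ≥0∞} (hδ : δ ≠ 0) : ∃ N : ℕ, volume E < volume (E ∩ ball 0 N) + δ := by
  have hmono : Monotone fun N : ℕ => E ∩ ball (0 : V) N := fun a b hab =>
    inter_subset_inter_right _ (ball_subset_ball (by exact_mod_cast hab))
  have h := tendsto_measure_iUnion_atTop (μ := volume) hmono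
  rw [← inter_iUnion, iUnion_ball_nat, inter_univ] at h
  have h' := h.add_const δ
  exact (h'.eventually_const_lt (ENNReal.lt_add_right hE hδ)).exists

theorem exists_lt_measure_ball_lt_add (r : ℝ) {δ : ℝ≥0∞} (hδ : δ ≠ 0) :
    ∃ s < r, volume (ball (0 : V) r) < volume (ball (0 : V) s) + δ := by
  have hmono : Monotone fun N : ℕ => ball (0 : V) (r - 1 / (N + 1)) := fun a b hab =>
    ball_subset_ball (sub_le_sub_left (one_div_le_one_div_of_le (by positivity) (by simpa)) _)
  have hU : ⋃ N : ℕ, ball (0 : V) (r - 1 / (N + 1)) = ball 0 r := by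
    ext x
    simp only [mem_iUnion, mem_ball_zero_iff]
    constructor
    · rintro ⟨N, hN⟩
      exact hN.trans (sub_lt_self _ (by positivity))
    · intro hx
      obtain ⟨N, hN⟩ := exists_nat_one_div_lt (sub_pos.2 hx)
      exact ⟨N, by linarith⟩
  have h := tendsto_measure_iUnion_atTop (μ := volume) hmono
  rw [hU] at h
  have h' := h.add_const δ
  obtain ⟨N, hN⟩ :=
    (h'.eventually_const_lt (ENNReal.lt_add_right measure_ball_lt_top.ne hδ)).exists
  exact ⟨_, sub_lt_self _ (by positivity), hN⟩

/-- The measurable sets of the same measure as `E`, with no larger interaction energy and at least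
as concentrated around the origin. -/
def concentrations (k : ℝ≥0∞ → ℝ≥0∞) (E : Set V) : Set (Set V) :=
  {F | MeasurableSet F ∧ volume F = volume E ∧ interaction volume k F ≤ interaction volume k E ∧
    ∀ ρ : ℝ, volume (E ∩ ball 0 ρ) ≤ volume (F ∩ ball 0 ρ)}

theorem polarize_mem_concentrations {k : ℝ≥0∞ → ℝ≥0∞} (hk : Antitone k) {E F : Set V}
    (hF : F ∈ concentrations k E) {w : V} (hw : w ≠ 0) :
    polarize (reflectTo w) F ∈ concentrations k E := by
  obtain ⟨h1, h2, h3, h4⟩ := hF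
  have hσ := isPolarizer_reflectTo w hw
  exact ⟨hσ.measurableSet_polarize h1, (hσ.measure_polarize h1).trans h2,
    (hσ.interaction_polarize_le hk h1).trans h3,
    fun ρ => (h4 ρ).trans (le_self_add.trans (hσ.measure_inter_ball_add_le h1 ρ))⟩

theorem iInf_measure_ball_sdiff_concentrations {k : ℝ≥0∞ → ℝ≥0∞} (hk : Antitone k) {E : Set V}
    (hE : MeasurableSet E) {r : ℝ} (hEr : volume E = volume (ball (0 : V) r)) :
    ⨅ F ∈ concentrations k E, volume (ball (0 : V) r \ F) = 0 := by
  set B : Set V := ball 0 r with hB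
  have hBm : MeasurableSet B := measurableSet_ball
  have hBtop : volume B ≠ ∞ := measure_ball_lt_top.ne
  set δ := ⨅ F ∈ concentrations k E, volume (B \ F) with hδ
  by_contra hδ0
  have hle : ∀ F ∈ concentrations k E, δ ≤ volume (B \ F) := fun F hF => iInf₂_le F hF
  have hEmem : E ∈ concentrations k E := ⟨hE, rfl, le_rfl, fun _ => le_rfl⟩
  have hδtop : δ ≠ ∞ :=
    ne_top_of_le_ne_top hBtop ((hle E hEmem).trans (measure_mono sdiff_subset))
  have hδ2 : δ / 2 ≠ 0 := by simpa using hδ0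
  have hδ2top : δ / 2 ≠ ∞ := (ENNReal.half_lt_self hδ0 hδtop).ne_top
  obtain ⟨N, hN⟩ := exists_nat_measure_lt_measure_inter_ball_add E (hEr ▸ hBtop) hδ2
  obtain ⟨s, hsr, hs⟩ := exists_lt_measure_ball_lt_add (V := V) r hδ2
  obtain ⟨c, hc0, hc⟩ := exists_reflectTo_measure_inter_ge (volume : Measure V) hsr N
  have hγ : c * (δ / 2 * (δ / 2)) ≠ 0 := mul_ne_zero hc0 (mul_ne_zero hδ2 hδ2)
  obtain ⟨F, hF⟩ := iInf_lt_iff.1 (ENNReal.lt_add_right hδtop hγ)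
  obtain ⟨hFmem, hFlt⟩ := iInf_lt_iff.1 hF
  obtain ⟨hFm, hFvol, -, hFball⟩ := id hFmem
  have hsymm : volume (F \ B) = volume (B \ F) :=
    measure_sdiff_symm hFm.nullMeasurableSet hBm.nullMeasurableSet (hFvol.trans hEr)
      (ne_top_of_le_ne_top hBtop (measure_mono inter_subset_right))
  have hA : δ / 2 ≤ volume (ball 0 s \ F) := by
    by_contra! hlt
    have h1 : volume (B \ F) ≤ volume (ball 0 s \ F) + volume (B \ ball 0 s) := by
      refine (measure_mono ?_).trans (measure_union_le _ _)
      rintro x ⟨hx1, hx2⟩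
      by_cases hx : x ∈ ball (0 : V) s
      · exact Or.inl ⟨hx, hx2⟩
      · exact Or.inr ⟨hx1, hx⟩
    have h2 : volume (B \ ball 0 s) ≤ δ / 2 := by
      rw [measure_sdiff (ball_subset_ball hsr.le) measurableSet_ball.nullMeasurableSet
        measure_ball_lt_top.ne, tsub_le_iff_left]
      exact hs.le
    have h3 := (hle F hFmem).trans h1
    have h4 := ENNReal.add_lt_add_of_lt_of_le
      (ne_top_of_le_ne_top hδ2top h2) hlt h2
    rw [ENNReal.add_halves] at h4
    exact h4.not_ge h3
  have hC : δ / 2 ≤ volume ((F \ B) ∩ ball 0 N) := by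
    by_contra! hlt
    have h1 : volume (F \ B) ≤ volume ((F \ B) ∩ ball 0 N) + volume (F \ ball 0 N) := by
      refine (measure_mono ?_).trans (measure_union_le _ _)
      rintro x ⟨hx1, hx2⟩
      by_cases hx : x ∈ ball (0 : V) N
      · exact Or.inl ⟨⟨hx1, hx2⟩, hx⟩
      · exact Or.inr ⟨hx1, hx⟩
    have h2 : volume (F \ ball 0 N) ≤ δ / 2 := by
      have hfin : volume (F ∩ ball 0 N) ≠ ∞ :=
        ne_top_of_le_ne_top measure_ball_lt_top.ne (measure_mono inter_subset_right)
      rw [← ENNReal.add_le_add_iff_left hfin, measure_inter_add_sdiff F measurableSet_ball, hFvol]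
      exact hN.le.trans (add_le_add (hFball N) le_rfl)
    have h3 := (hle F hFmem).trans (hsymm ▸ h1)
    have h4 := ENNReal.add_lt_add_of_lt_of_le
      (ne_top_of_le_ne_top hδ2top h2) hlt h2
    rw [ENNReal.add_halves] at h4
    exact h4.not_ge h3
  obtain ⟨w, hw, hgain⟩ := hc (ball 0 s \ F) ((F \ B) ∩ ball 0 N) (measurableSet_ball.diff hFm)
    ((hFm.diff hBm).inter measurableSet_ball) (fun h => hδ2 (le_zero_iff.1 (h ▸ hA)))
    (fun h => hδ2 (le_zero_iff.1 (h ▸ hC))) (fun x hx => (mem_ball_zero_iff.1 hx.1).le)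
    (fun y hy => ⟨not_lt.1 fun h => hy.1.2 (mem_ball_zero_iff.2 h),
      (mem_ball_zero_iff.1 hy.2).le⟩)
  have hgain' : c * (δ / 2 * (δ / 2)) ≤ volume ((B \ F) ∩ reflectTo w ⁻¹' (F \ B)) := by
    refine le_trans ?_ (hgain.trans (measure_mono ?_))
    · gcongr
    · exact inter_subset_inter (sdiff_subset_sdiff_left (ball_subset_ball hsr.le))
        (preimage_mono inter_subset_left)
  have hpol := (isPolarizer_reflectTo w hw).measure_inter_ball_add_le hFm r
  have hmem' := polarize_mem_concentrations hk hFmem hw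
  set F' := polarize (reflectTo w) F with hF'
  have hsplit : ∀ G : Set V, MeasurableSet G → volume (G ∩ B) + volume (B \ G) = volume B :=
    fun G hG => by rw [inter_comm]; exact measure_inter_add_sdiff B hG
  have hfin : volume (F ∩ B) ≠ ∞ := ne_top_of_le_ne_top hBtop (measure_mono inter_subset_right)
  have h5 : volume (F ∩ B) + (c * (δ / 2 * (δ / 2)) + volume (B \ F'))
      ≤ volume (F ∩ B) + volume (B \ F) := by
    rw [hsplit F hFm, ← hsplit F' hmem'.1, ← add_assoc]
    gcongr
    exact (add_le_add_right hgain' _).trans hpol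
  have h6 := (ENNReal.add_le_add_iff_left hfin).1 h5
  have h7 : δ + c * (δ / 2 * (δ / 2)) ≤ volume (B \ F) := by
    rw [add_comm]
    exact (add_le_add_right (hle F' hmem') _).trans h6
  exact hFlt.not_ge h7

/-- Balls minimize the interaction energy with the complement among sets of given measure. -/
theorem interaction_ball_le {k : ℝ≥0∞ → ℝ≥0∞} (hk : Antitone k) {E : Set V}
    (hE : MeasurableSet E) {r : ℝ} (hEr : volume E = volume (ball (0 : V) r)) :
    interaction volume k (ball (0 : V) r) ≤ interaction volume k E := by
  set B : Set V := ball 0 r with hB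
  have hBm : MeasurableSet B := measurableSet_ball
  have hBtop : volume B ≠ ∞ := measure_ball_lt_top.ne
  have hex : ∀ i : ℕ, ∃ F ∈ concentrations k E, volume (B \ F) < (2⁻¹ : ℝ≥0∞) ^ i := by
    intro i
    have h : ⨅ F ∈ concentrations k E, volume (B \ F) < (2⁻¹ : ℝ≥0∞) ^ i := by
      rw [iInf_measure_ball_sdiff_concentrations hk hE hEr]
      exact ENNReal.pow_pos (by simp) i
    obtain ⟨F, hF⟩ := iInf_lt_iff.1 h
    obtain ⟨hFmem, hFlt⟩ := iInf_lt_iff.1 hF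
    exact ⟨F, hFmem, hFlt⟩
  choose F hF hlt using hex
  have hsymm : ∀ i, volume (F i \ B) = volume (B \ F i) := fun i =>
    measure_sdiff_symm (hF i).1.nullMeasurableSet hBm.nullMeasurableSet ((hF i).2.1.trans hEr)
      (ne_top_of_le_ne_top hBtop (measure_mono inter_subset_right))
  have hsum : ∑' i, volume (B \ F i) ≠ ∞ := by
    refine ne_top_of_le_ne_top ?_ (ENNReal.tsum_le_tsum fun i => (hlt i).le)
    rw [ENNReal.tsum_geometric]
    simp
  have hae : ∀ᵐ x : V, ∀ᶠ i in Filter.atTop, (x ∈ F i ↔ x ∈ B) := by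
    filter_upwards [ae_eventually_notMem hsum,
      ae_eventually_notMem (s := fun i => F i \ B) (by simpa only [hsymm] using hsum)] with x h1 h2
    filter_upwards [h1, h2] with i h1 h2
    simp only [mem_sdiff, not_and, not_not] at h1 h2
    exact ⟨h2, h1⟩
  calc interaction volume k B
      ≤ ∫⁻ p, Filter.liminf (fun i => (F i ×ˢ (F i)ᶜ).indicator
          (fun p : V × V => k (edist p.1 p.2)) p) Filter.atTop ∂(volume.prod volume) := by
        refine lintegral_mono_ae ?_
        filter_upwards [Measure.quasiMeasurePreserving_fst.ae hae,
          Measure.quasiMeasurePreserving_snd.ae hae] with p h1 h2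
        refine Filter.le_liminf_of_le (by isBoundedDefault) ?_
        filter_upwards [h1, h2] with i h1 h2
        refine le_of_eq (indicator_eq_indicator ?_ rfl)
        simp only [mem_prod, mem_compl_iff, h1, h2]
    _ ≤ Filter.liminf (fun i => interaction volume k (F i)) Filter.atTop :=
        lintegral_liminf_le fun i => measurable_interaction_integrand hk (hF i).1
    _ ≤ interaction volume k E := by
        refine (Filter.liminf_le_liminf (Filter.Eventually.of_forall fun i => (hF i).2.2.1)).trans
          ?_
        rw [Filter.liminf_const]

end Rearrangement

section FreeEnergy

variable {n : ℕ} {α ν : ℝ} {h : ℝ → ℝ}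

theorem antitone_rpow_neg {s : ℝ} (hs : 0 ≤ s) : Antitone fun t : ℝ≥0∞ => t ^ (-s) := by
  intro a b hab
  simp only [ENNReal.rpow_neg]
  exact ENNReal.inv_le_inv.2 (ENNReal.rpow_le_rpow hab hs)

theorem fracPerimeter_eq_interaction {E : Set (EuclideanSpace ℝ (Fin n))}
    (hE : MeasurableSet E) :
    fracPerimeter n α E = interaction volume (fun t => t ^ (-((n : ℝ) + α))) E := by
  have hk : Measurable fun p : EuclideanSpace ℝ (Fin n) × EuclideanSpace ℝ (Fin n) =>
      edist p.1 p.2 ^ (-((n : ℝ) + α)) := by fun_prop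
  rw [interaction, lintegral_indicator (hE.prod hE.compl), ← Measure.prod_restrict,
    lintegral_prod _ hk.aemeasurable, fracPerimeter]
  refine setLIntegral_congr_fun hE fun x hx => setLIntegral_congr_fun hE.compl fun y hy => ?_
  have hxy : x ≠ y := fun hxy => hy (hxy ▸ hx)
  simp only
  rw [edist_dist, dist_eq_norm, ENNReal.ofReal_rpow_of_pos (norm_pos_iff.2 (sub_ne_zero.2 hxy))]

theorem fracPerimeter_ball_le (hα : 0 < α) {E : Set (EuclideanSpace ℝ (Fin n))}
    (hE : MeasurableSet E) {r : ℝ}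
    (hEr : volume E = volume (ball (0 : EuclideanSpace ℝ (Fin n)) r)) :
    fracPerimeter n α (ball 0 r) ≤ fracPerimeter n α E := by
  rw [fracPerimeter_eq_interaction hE, fracPerimeter_eq_interaction measurableSet_ball]
  exact interaction_ball_le (antitone_rpow_neg (by positivity)) hE hEr

theorem setLIntegral_comp_smul {r : ℝ} (hr : 0 < r) (S : Set (EuclideanSpace ℝ (Fin n)))
    (f : EuclideanSpace ℝ (Fin n) → ℝ≥0∞) :
    ∫⁻ x in S, f x = ENNReal.ofReal (r ^ n) * ∫⁻ x in (r • ·) ⁻¹' S, f (r • x) := by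
  have he : MeasurableEmbedding fun x : EuclideanSpace ℝ (Fin n) => r • x :=
    measurableEmbedding_const_smul₀ hr.ne'
  have hmap : (volume : Measure (EuclideanSpace ℝ (Fin n))) =
      ENNReal.ofReal (r ^ n) • Measure.map (r • ·) volume := by
    rw [Measure.map_addHaar_smul _ hr.ne', finrank_euclideanSpace_fin, smul_smul,
      ← ENNReal.ofReal_mul (by positivity), abs_of_pos (by positivity),
      mul_inv_cancel₀ (by positivity), ENNReal.ofReal_one, one_smul]
  conv_lhs => rw [hmap]
  rw [Measure.restrict_smul, lintegral_smul_measure, he.restrict_map, he.lintegral_map, smul_eq_mul]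

theorem preimage_smul_ball {r : ℝ} (hr : 0 < r) :
    (r • ·) ⁻¹' ball (0 : EuclideanSpace ℝ (Fin n)) r = ball 0 1 := by
  ext x
  simp [norm_smul, abs_of_pos hr, hr]

theorem fracPerimeter_ball {r : ℝ} (hr : 0 < r) :
    fracPerimeter n α (ball 0 r) =
      ENNReal.ofReal (r ^ ((n : ℝ) - α)) * fracPerimeter n α (ball 0 1) := by
  have hinner : ∀ x : EuclideanSpace ℝ (Fin n),
      ∫⁻ y in (ball 0 r)ᶜ, ENNReal.ofReal (‖r • x - y‖ ^ (-((n : ℝ) + α))) =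
        ENNReal.ofReal (r ^ (-α)) *
          ∫⁻ y in (ball 0 1)ᶜ, ENNReal.ofReal (‖x - y‖ ^ (-((n : ℝ) + α))) := by
    intro x
    rw [setLIntegral_comp_smul hr, preimage_compl, preimage_smul_ball hr]
    have hxy : ∀ y : EuclideanSpace ℝ (Fin n),
        ENNReal.ofReal (‖r • x - r • y‖ ^ (-((n : ℝ) + α))) =
          ENNReal.ofReal (r ^ (-((n : ℝ) + α))) *
            ENNReal.ofReal (‖x - y‖ ^ (-((n : ℝ) + α))) := by
      intro y
      rw [← smul_sub, norm_smul, Real.norm_of_nonneg hr.le, Real.mul_rpow hr.le (norm_nonneg _),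
        ENNReal.ofReal_mul (by positivity)]
    simp_rw [hxy]
    rw [lintegral_const_mul' _ _ ENNReal.ofReal_ne_top, ← mul_assoc,
      ← ENNReal.ofReal_mul (by positivity), ← Real.rpow_natCast, ← Real.rpow_add hr]
    ring_nf
  rw [fracPerimeter, setLIntegral_comp_smul hr, preimage_smul_ball hr]
  simp_rw [hinner]
  rw [lintegral_const_mul' _ _ ENNReal.ofReal_ne_top, ← mul_assoc,
    ← ENNReal.ofReal_mul (by positivity), ← Real.rpow_natCast, ← Real.rpow_add hr, fracPerimeter,
    sub_eq_add_neg]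

theorem setLIntegral_ball_homogeneous
    (hhom : ∀ t r : ℝ, 0 ≤ t → 0 ≤ r → h (t * r) = t ^ ν * h r) {r : ℝ} (hr : 0 < r) :
    ∫⁻ x in ball (0 : EuclideanSpace ℝ (Fin n)) r, ENNReal.ofReal (h ‖x‖) =
      ENNReal.ofReal (r ^ ((n : ℝ) + ν)) *
        ∫⁻ x in ball (0 : EuclideanSpace ℝ (Fin n)) 1, ENNReal.ofReal (h ‖x‖) := by
  rw [setLIntegral_comp_smul hr, preimage_smul_ball hr]
  have hx : ∀ x : EuclideanSpace ℝ (Fin n),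
      ENNReal.ofReal (h ‖r • x‖) = ENNReal.ofReal (r ^ ν) * ENNReal.ofReal (h ‖x‖) := by
    intro x
    rw [norm_smul, Real.norm_of_nonneg hr.le, hhom _ _ hr.le (norm_nonneg x),
      ENNReal.ofReal_mul (by positivity)]
  simp_rw [hx]
  rw [lintegral_const_mul' _ _ ENNReal.ofReal_ne_top, ← mul_assoc,
    ← ENNReal.ofReal_mul (by positivity), ← Real.rpow_natCast, ← Real.rpow_add hr]

theorem setLIntegral_ball_le_of_monotoneOn (hmono : MonotoneOn h (Ici 0))
    {E : Set (EuclideanSpace ℝ (Fin n))} (hE : MeasurableSet E) {r : ℝ} (hr : 0 ≤ r)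
    (hEr : volume E = volume (ball (0 : EuclideanSpace ℝ (Fin n)) r)) :
    ∫⁻ x in ball (0 : EuclideanSpace ℝ (Fin n)) r, ENNReal.ofReal (h ‖x‖) ≤
      ∫⁻ x in E, ENNReal.ofReal (h ‖x‖) := by
  set B : Set (EuclideanSpace ℝ (Fin n)) := ball 0 r
  have hB : MeasurableSet B := measurableSet_ball
  have hsymm : volume (B \ E) = volume (E \ B) :=
    measure_sdiff_symm hB.nullMeasurableSet hE.nullMeasurableSet hEr.symm
      (ne_top_of_le_ne_top measure_ball_lt_top.ne (measure_mono inter_subset_left))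
  rw [← lintegral_inter_add_sdiff _ B hE, ← lintegral_inter_add_sdiff _ E hB, inter_comm E B]
  refine add_le_add_right ?_ _
  calc ∫⁻ x in B \ E, ENNReal.ofReal (h ‖x‖)
      ≤ ∫⁻ _ in B \ E, ENNReal.ofReal (h r) := by
        refine setLIntegral_mono' (hB.diff hE) fun x hx => ENNReal.ofReal_le_ofReal ?_
        exact hmono (norm_nonneg x) hr (mem_ball_zero_iff.1 hx.1).le
    _ = ∫⁻ _ in E \ B, ENNReal.ofReal (h r) := by
        rw [setLIntegral_const, setLIntegral_const, hsymm]
    _ ≤ ∫⁻ x in E \ B, ENNReal.ofReal (h ‖x‖) := by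
        refine setLIntegral_mono' (hE.diff hB) fun x hx => ENNReal.ofReal_le_ofReal ?_
        exact hmono hr (norm_nonneg x) (not_lt.1 fun hlt => hx.2 (mem_ball_zero_iff.2 hlt))

theorem minEnergy_eq_freeEnergy_ball (hα : 0 < α) (hmono : MonotoneOn h (Ici 0)) {m r : ℝ}
    (hr : 0 ≤ r)
    (hmr : volume (ball (0 : EuclideanSpace ℝ (Fin n)) r) = ENNReal.ofReal m) :
    minEnergy n α (fun x => h ‖x‖) m = freeEnergy n α (fun x => h ‖x‖) (ball 0 r) := by
  refine le_antisymm (iInf₂_le _ ⟨measurableSet_ball, hmr⟩) (le_iInf₂ fun E hE => ?_)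
  have hEr := hE.2.trans hmr.symm
  exact add_le_add (fracPerimeter_ball_le hα hE.1 hEr)
    (setLIntegral_ball_le_of_monotoneOn hmono hE.1 hr hEr)

theorem minEnergy_eq (hn : n ≠ 0) (hα : 0 < α) (hmono : MonotoneOn h (Ici 0))
    (hhom : ∀ t r : ℝ, 0 ≤ t → 0 ≤ r → h (t * r) = t ^ ν * h r) {m : ℝ} (hm : 0 < m) :
    minEnergy n α (fun x => h ‖x‖) m =
      fracPerimeter n α (ball (0 : EuclideanSpace ℝ (Fin n)) 1)
          * (volume (ball (0 : EuclideanSpace ℝ (Fin n)) 1)) ^ (-(((n : ℝ) - α) / n))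
          * (ENNReal.ofReal m) ^ (((n : ℝ) - α) / n)
        + (∫⁻ x in ball (0 : EuclideanSpace ℝ (Fin n)) 1, ENNReal.ofReal (h ‖x‖))
          * (volume (ball (0 : EuclideanSpace ℝ (Fin n)) 1)) ^ (-(((n : ℝ) + ν) / n))
          * (ENNReal.ofReal m) ^ (((n : ℝ) + ν) / n) := by
  have hVtop : volume (ball (0 : EuclideanSpace ℝ (Fin n)) 1) ≠ ∞ := measure_ball_lt_top.ne
  have hV : 0 < (volume (ball (0 : EuclideanSpace ℝ (Fin n)) 1)).toReal :=
    ENNReal.toReal_pos (measure_ball_pos _ _ one_pos).ne' hVtop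
  set V := (volume (ball (0 : EuclideanSpace ℝ (Fin n)) 1)).toReal
  have hVeq : volume (ball (0 : EuclideanSpace ℝ (Fin n)) 1) = ENNReal.ofReal V :=
    (ENNReal.ofReal_toReal hVtop).symm
  have hr : 0 < (m / V) ^ ((n : ℝ)⁻¹) := by positivity
  have hpow : ∀ e : ℝ, ENNReal.ofReal (((m / V) ^ ((n : ℝ)⁻¹)) ^ e) =
      ENNReal.ofReal V ^ (-(e / n)) * ENNReal.ofReal m ^ (e / n) := by
    intro e
    rw [ENNReal.ofReal_rpow_of_pos hV, ENNReal.ofReal_rpow_of_pos hm,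
      ← ENNReal.ofReal_mul (by positivity), ← Real.rpow_mul (by positivity),
      Real.div_rpow hm.le hV.le, Real.rpow_neg hV.le, inv_mul_eq_div, inv_mul_eq_div]
  have hmr : volume (ball (0 : EuclideanSpace ℝ (Fin n)) ((m / V) ^ ((n : ℝ)⁻¹))) =
      ENNReal.ofReal m := by
    rw [Measure.addHaar_ball_of_pos _ _ hr, finrank_euclideanSpace_fin, hVeq,
      Real.rpow_inv_natCast_pow (by positivity) hn, ← ENNReal.ofReal_mul (by positivity),
      div_mul_cancel₀ _ hV.ne']
  rw [minEnergy_eq_freeEnergy_ball hα hmono hr.le hmr, freeEnergy, fracPerimeter_ball hr,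
    setLIntegral_ball_homogeneous hhom hr, hpow, hpow, hVeq]
  ring

end FreeEnergy

section SumOfPowers

variable {a b p q M : ℝ}

theorem hasDerivAt_add_rpow {x : ℝ} (hx : x ≠ 0) :
    HasDerivAt (fun x : ℝ => a * x ^ p + b * x ^ q)
      (a * p * x ^ (p - 1) + b * q * x ^ (q - 1)) x := by
  have h1 := ((Real.hasDerivAt_rpow_const (p := p) (Or.inl hx)).const_mul a).fun_add
    ((Real.hasDerivAt_rpow_const (p := q) (Or.inl hx)).const_mul b)
  simpa only [mul_assoc] using h1

theorem second_deriv_add_rpow_eq (hM : b * (q * (q - 1)) * M ^ (q - p) = a * (p * (1 - p)))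
    {x : ℝ} (hx : 0 < x) :
    a * p * (p - 1) * x ^ (p - 1 - 1) + b * q * (q - 1) * x ^ (q - 1 - 1) =
      b * (q * (q - 1)) * x ^ (p - 1 - 1) * (x ^ (q - p) - M ^ (q - p)) := by
  have hq : x ^ (q - 1 - 1) = x ^ (p - 1 - 1) * x ^ (q - p) := by
    rw [← Real.rpow_add hx]
    ring_nf
  rw [hq]
  linear_combination x ^ (p - 1 - 1) * hM

theorem concaveOn_add_rpow (hb : 0 ≤ b) (hq : 1 ≤ q) (hpq : p ≤ q)
    (hM : b * (q * (q - 1)) * M ^ (q - p) = a * (p * (1 - p))) :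
    ConcaveOn ℝ (Ioo 0 M) fun x : ℝ => a * x ^ p + b * x ^ q := by
  have hd : ∀ (a b p q : ℝ), ∀ x ∈ Ioo 0 M, HasDerivAt (fun x : ℝ => a * x ^ p + b * x ^ q)
      (a * p * x ^ (p - 1) + b * q * x ^ (q - 1)) x :=
    fun a b p q x hx => hasDerivAt_add_rpow hx.1.ne'
  refine concaveOn_of_hasDerivWithinAt2_nonpos (convex_Ioo 0 M)
    (fun x hx => (hd a b p q x hx).continuousAt.continuousWithinAt)
    (fun x hx => (hd a b p q x (interior_subset hx)).hasDerivWithinAt)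
    (fun x hx => (hd (a * p) (b * q) (p - 1) (q - 1) x (interior_subset hx)).hasDerivWithinAt) ?_
  rw [interior_Ioo]
  rintro x ⟨hx0, hxM⟩
  rw [second_deriv_add_rpow_eq hM hx0]
  have hle : x ^ (q - p) ≤ M ^ (q - p) :=
    Real.rpow_le_rpow hx0.le hxM.le (sub_nonneg.2 hpq)
  have hq0 : 0 ≤ q * (q - 1) := mul_nonneg (by linarith) (by linarith)
  exact mul_nonpos_of_nonneg_of_nonpos (by positivity) (sub_nonpos.2 hle)

theorem convexOn_add_rpow (hb : 0 ≤ b) (hq : 1 ≤ q) (hpq : p ≤ q) (hM0 : 0 ≤ M)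
    (hM : b * (q * (q - 1)) * M ^ (q - p) = a * (p * (1 - p))) :
    ConvexOn ℝ (Ioi M) fun x : ℝ => a * x ^ p + b * x ^ q := by
  have hd : ∀ (a b p q : ℝ), ∀ x ∈ Ioi M, HasDerivAt (fun x : ℝ => a * x ^ p + b * x ^ q)
      (a * p * x ^ (p - 1) + b * q * x ^ (q - 1)) x :=
    fun a b p q x hx => hasDerivAt_add_rpow (hM0.trans_lt hx).ne'
  refine convexOn_of_hasDerivWithinAt2_nonneg (convex_Ioi M)
    (fun x hx => (hd a b p q x hx).continuousAt.continuousWithinAt)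
    (fun x hx => (hd a b p q x (interior_subset hx)).hasDerivWithinAt)
    (fun x hx => (hd (a * p) (b * q) (p - 1) (q - 1) x (interior_subset hx)).hasDerivWithinAt) ?_
  rw [interior_Ioi]
  intro x hxM
  have hx0 : 0 < x := hM0.trans_lt hxM
  rw [second_deriv_add_rpow_eq hM hx0]
  have hle : M ^ (q - p) ≤ x ^ (q - p) :=
    Real.rpow_le_rpow hM0 (le_of_lt hxM) (sub_nonneg.2 hpq)
  have hq0 : 0 ≤ q * (q - 1) := mul_nonneg (by linarith) (by linarith)
  exact mul_nonneg (by positivity) (sub_nonneg.2 hle)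

/-- The critical mass is the inflection point of the minimal energy. -/
theorem critical_mass_identity {n α ν V P G : ℝ} (hn : 0 < n) (hα : 0 < α) (hαn : α ≤ n)
    (hν : 0 < ν) (hV : 0 < V) (hP : 0 ≤ P) (hG : 0 < G) :
    G * V ^ (-((n + ν) / n)) * ((n + ν) / n * ((n + ν) / n - 1)) *
        (V * (α * (n - α) / (ν * (n + ν)) * P / G) ^ (n / (ν + α))) ^
          ((n + ν) / n - (n - α) / n) =
      P * V ^ (-((n - α) / n)) * ((n - α) / n * (1 - (n - α) / n)) := by
  have hX : 0 ≤ α * (n - α) / (ν * (n + ν)) * P / G := by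
    have := sub_nonneg.2 hαn
    positivity
  have he : (n + ν) / n - (n - α) / n = (ν + α) / n := by
    field_simp
    ring
  have hpow : V ^ (-((n + ν) / n)) * V ^ ((ν + α) / n) = V ^ (-((n - α) / n)) := by
    rw [← Real.rpow_add hV, ← he]
    ring_nf
  have h1 : n / (ν + α) * ((ν + α) / n) = 1 := by
    have : ν + α ≠ 0 := by positivity
    field_simp
  rw [he, Real.mul_rpow hV.le (by positivity), ← Real.rpow_mul hX, h1, Real.rpow_one, ← hpow]
  have : n + ν ≠ 0 := by positivity
  field_simp
  ring

end SumOfPowers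

theorem continuous_homogeneous_norm {V : Type*} [SeminormedAddCommGroup V] {h : ℝ → ℝ} {ν : ℝ}
    (hν : 0 < ν) (hhom : ∀ t r : ℝ, 0 ≤ t → 0 ≤ r → h (t * r) = t ^ ν * h r) :
    Continuous fun x : V => h ‖x‖ := by
  have heq : (fun x : V => h ‖x‖) = fun x => ‖x‖ ^ ν * h 1 := by
    ext x
    rw [← hhom _ _ (norm_nonneg x) zero_le_one, mul_one]
  rw [heq]
  exact (continuous_norm.rpow_const fun _ => Or.inr hν.le).mul_const _

theorem homogeneous_pos {h : ℝ → ℝ} {ν : ℝ} (hpos : ∀ t : ℝ, 0 ≤ t → 0 ≤ h t)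
    (hnontriv : ∃ t : ℝ, 0 ≤ t ∧ h t ≠ 0)
    (hhom : ∀ t r : ℝ, 0 ≤ t → 0 ≤ r → h (t * r) = t ^ ν * h r) {t : ℝ} (ht : 0 < t) : 0 < h t := by
  refine (hpos t ht.le).lt_of_ne' fun h0 => ?_
  obtain ⟨s, hs, hs0⟩ := hnontriv
  refine hs0 ?_
  rw [← div_mul_cancel₀ s ht.ne', hhom _ _ (by positivity) ht.le, h0, mul_zero]

theorem integrableOn_ball_homogeneous {n : ℕ} {h : ℝ → ℝ} {ν : ℝ} (hν : 0 < ν)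
    (hhom : ∀ t r : ℝ, 0 ≤ t → 0 ≤ r → h (t * r) = t ^ ν * h r) :
    IntegrableOn (fun x : EuclideanSpace ℝ (Fin n) => h ‖x‖) (ball 0 1) :=
  ((continuous_homogeneous_norm hν hhom).continuousOn.integrableOn_compact
    (isCompact_closedBall 0 1)).mono_set ball_subset_closedBall

theorem setIntegral_ball_homogeneous_pos {n : ℕ} (hn : n ≠ 0) {h : ℝ → ℝ} {ν : ℝ} (hν : 0 < ν)
    (hpos : ∀ t : ℝ, 0 ≤ t → 0 ≤ h t) (hnontriv : ∃ t : ℝ, 0 ≤ t ∧ h t ≠ 0)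
    (hhom : ∀ t r : ℝ, 0 ≤ t → 0 ≤ r → h (t * r) = t ^ ν * h r) :
    0 < ∫ x in ball (0 : EuclideanSpace ℝ (Fin n)) 1, h ‖x‖ := by
  have : Nonempty (Fin n) := ⟨⟨0, Nat.pos_of_ne_zero hn⟩⟩
  rw [setIntegral_pos_iff_support_of_nonneg_ae
    (Filter.Eventually.of_forall fun x => hpos _ (norm_nonneg x))
    (integrableOn_ball_homogeneous hν hhom)]
  refine lt_of_lt_of_le ?_ (measure_mono (s := ball 0 1 \ {0}) fun x hx => ⟨?_, hx.1⟩)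
  · rw [measure_sdiff_null (measure_singleton _)]
    exact measure_ball_pos _ _ one_pos
  · exact (homogeneous_pos hpos hnontriv hhom (norm_pos_iff.2 hx.2)).ne'

/-- For a nondecreasing, not identically zero, positively `ν`-homogeneous radial potential,
the minimal energy has an explicit form and is concave below the critical mass and convex
above it. -/
theorem stmt_6 (n : ℕ) (hn : 2 ≤ n) (α : ℝ) (hα : α ∈ Set.Ioo (0 : ℝ) 1)
    (ν : ℝ) (hν : 0 < ν)
    (h : ℝ → ℝ) (hmono : MonotoneOn h (Set.Ici 0)) (hpos : ∀ t : ℝ, 0 ≤ t → 0 ≤ h t)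
    (hnontriv : ∃ t : ℝ, 0 ≤ t ∧ h t ≠ 0)
    (hhom : ∀ t r : ℝ, 0 ≤ t → 0 ≤ r → h (t * r) = t ^ ν * h r) :
    (∀ m : ℝ, 0 < m →
      minEnergy n α (fun x => h ‖x‖) m =
        fracPerimeter n α (ball (0 : EuclideanSpace ℝ (Fin n)) 1)
            * (volume (ball (0 : EuclideanSpace ℝ (Fin n)) 1)) ^ (-(((n : ℝ) - α) / n))
            * (ENNReal.ofReal m) ^ (((n : ℝ) - α) / n)
          + (∫⁻ x in ball (0 : EuclideanSpace ℝ (Fin n)) 1, ENNReal.ofReal (h ‖x‖))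
            * (volume (ball (0 : EuclideanSpace ℝ (Fin n)) 1)) ^ (-(((n : ℝ) + ν) / n))
            * (ENNReal.ofReal m) ^ (((n : ℝ) + ν) / n)) ∧
    (ConcaveOn ℝ
      (Set.Ioo 0
        ((volume (ball (0 : EuclideanSpace ℝ (Fin n)) 1)).toReal *
          ((α * ((n : ℝ) - α)) / (ν * ((n : ℝ) + ν)) *
              (fracPerimeter n α (ball (0 : EuclideanSpace ℝ (Fin n)) 1)).toReal /
              (∫ x in ball (0 : EuclideanSpace ℝ (Fin n)) 1, h ‖x‖)) ^ ((n : ℝ) / (ν + α))))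
      (fun m => (minEnergy n α (fun x => h ‖x‖) m).toReal)) ∧
    (ConvexOn ℝ
      (Set.Ioi
        ((volume (ball (0 : EuclideanSpace ℝ (Fin n)) 1)).toReal *
          ((α * ((n : ℝ) - α)) / (ν * ((n : ℝ) + ν)) *
              (fracPerimeter n α (ball (0 : EuclideanSpace ℝ (Fin n)) 1)).toReal /
              (∫ x in ball (0 : EuclideanSpace ℝ (Fin n)) 1, h ‖x‖)) ^ ((n : ℝ) / (ν + α))))
      (fun m => (minEnergy n α (fun x => h ‖x‖) m).toReal)) := by
  have hn0 : n ≠ 0 := by omega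
  have hnpos : (0 : ℝ) < n := by positivity
  have hform := fun (m : ℝ) (hm : 0 < m) => minEnergy_eq hn0 hα.1 hmono hhom hm
  refine ⟨hform, ?_⟩
  have hVtop : volume (ball (0 : EuclideanSpace ℝ (Fin n)) 1) ≠ ∞ := measure_ball_lt_top.ne
  have hV : 0 < (volume (ball (0 : EuclideanSpace ℝ (Fin n)) 1)).toReal :=
    ENNReal.toReal_pos (measure_ball_pos _ _ one_pos).ne' hVtop
  have hG := setIntegral_ball_homogeneous_pos hn0 hν hpos hnontriv hhom
  have hGeq : ∫⁻ x in ball (0 : EuclideanSpace ℝ (Fin n)) 1, ENNReal.ofReal (h ‖x‖) =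
      ENNReal.ofReal (∫ x in ball (0 : EuclideanSpace ℝ (Fin n)) 1, h ‖x‖) :=
    (ofReal_integral_eq_lintegral_ofReal (integrableOn_ball_homogeneous hν hhom)
      (Filter.Eventually.of_forall fun x => hpos _ (norm_nonneg x))).symm
  set P := fracPerimeter n α (ball (0 : EuclideanSpace ℝ (Fin n)) 1)
  set G := ∫ x in ball (0 : EuclideanSpace ℝ (Fin n)) 1, h ‖x‖
  set V := (volume (ball (0 : EuclideanSpace ℝ (Fin n)) 1)).toReal
  have hVeq : volume (ball (0 : EuclideanSpace ℝ (Fin n)) 1) = ENNReal.ofReal V :=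
    (ENNReal.ofReal_toReal hVtop).symm
  have hαn : α ≤ n := hα.2.le.trans (by exact_mod_cast Nat.one_le_iff_ne_zero.2 hn0)
  have hM0 : 0 ≤ V * ((α * ((n : ℝ) - α)) / (ν * ((n : ℝ) + ν)) * P.toReal / G) ^
      ((n : ℝ) / (ν + α)) := by
    have := hα.1.le
    have := sub_nonneg.2 hαn
    positivity
  have hM := critical_mass_identity hnpos hα.1 hαn hν hV (ENNReal.toReal_nonneg (a := P)) hG
  set M := V * ((α * ((n : ℝ) - α)) / (ν * ((n : ℝ) + ν)) * P.toReal / G) ^ ((n : ℝ) / (ν + α))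
  have hsub : Ioo 0 M ⊆ Ioi 0 := Ioo_subset_Ioi_self
  have hsub' : Ioi M ⊆ Ioi 0 := Ioi_subset_Ioi hM0
  by_cases hP : P = ∞
  · have hzero : EqOn (fun _ => (0 : ℝ)) (fun m => (minEnergy n α (fun x => h ‖x‖) m).toReal)
        (Ioi 0) := by
      intro m hm
      have hm' : (0 : ℝ) < m := hm
      have hne : ∀ (x : ℝ) (e : ℝ), 0 < x → ENNReal.ofReal x ^ e ≠ 0 := fun x e hx =>
        (ENNReal.rpow_pos (ENNReal.ofReal_pos.2 hx) ENNReal.ofReal_ne_top).ne'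
      simp only
      rw [hform m hm', hP, hVeq, ENNReal.top_mul (hne _ _ hV), ENNReal.top_mul (hne _ _ hm'),
        top_add, ENNReal.toReal_top]
    exact ⟨(concaveOn_const 0 (convex_Ioo 0 M)).congr (hzero.mono hsub),
      (convexOn_const 0 (convex_Ioi M)).congr (hzero.mono hsub')⟩
  · have hpow : EqOn (fun m : ℝ => P.toReal * V ^ (-(((n : ℝ) - α) / n)) * m ^ (((n : ℝ) - α) / n)
        + G * V ^ (-(((n : ℝ) + ν) / n)) * m ^ (((n : ℝ) + ν) / n))
        (fun m => (minEnergy n α (fun x => h ‖x‖) m).toReal) (Ioi 0) := by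
      intro m hm
      have hm' : (0 : ℝ) < m := hm
      simp only
      rw [hform m hm', hGeq, hVeq, ← ENNReal.ofReal_toReal hP]
      simp only [ENNReal.ofReal_rpow_of_pos hV, ENNReal.ofReal_rpow_of_pos hm']
      have hP0 := ENNReal.toReal_nonneg (a := P)
      rw [← ENNReal.ofReal_mul (by positivity), ← ENNReal.ofReal_mul (by positivity),
        ← ENNReal.ofReal_mul (by positivity), ← ENNReal.ofReal_mul (by positivity),
        ← ENNReal.ofReal_add (by positivity) (by positivity), ENNReal.toReal_ofReal hP0,
        ENNReal.toReal_ofReal (by positivity)]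
    have hb : 0 ≤ G * V ^ (-(((n : ℝ) + ν) / n)) := by positivity
    have hq : 1 ≤ ((n : ℝ) + ν) / n := by
      rw [one_le_div hnpos]
      linarith
    have hpq : ((n : ℝ) - α) / n ≤ ((n : ℝ) + ν) / n :=
      div_le_div_of_nonneg_right (by linarith [hα.1]) hnpos.le
    exact ⟨(concaveOn_add_rpow hb hq hpq hM).congr (hpow.mono hsub),
      (convexOn_add_rpow hb hq hpq hM0 hM).congr (hpow.mono hsub')⟩
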